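/- Let h and t be positive integers with ht ≢ 0 (mod 3). Then there does not exist a cyclic skew frame starter of type h^{3t} in Z_{3ht}. -/

import Mathlib

/-- The family `f`, indexed by `Fin m ⊕ Fin m`, hits each element of `G \\ H`
exactly once. -/
def CoversComplement {G : Type*} [AddCommGroup G] (H : AddSubgroup G) {m : ℕ}
    (f : Fin m ⊕ Fin m → G) : Prop :=
  Function.Injective f ∧ Set.range f = {z : G | z ∉ H}

/-- The pairs `{x i, y i}` form a frame starter in `G \\ H`: the entries hit each
element of `G \\ H` exactly once, and so do the differences `±(x i - y i)`. -/
def IsFrameStarter {G : Type*} [AddCommGroup G] (H : AddSubgroup G) {m : ℕ}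
    (x y : Fin m → G) : Prop :=
  CoversComplement H (Sum.elim x y) ∧
    CoversComplement H (Sum.elim (fun i => x i - y i) (fun i => y i - x i))

/-- A frame starter is strong if the sums `x i + y i` avoid `H` and are pairwise
distinct. -/
def IsStrongFS {G : Type*} [AddCommGroup G] (H : AddSubgroup G) {m : ℕ}
    (x y : Fin m → G) : Prop :=
  (∀ i, x i + y i ∉ H) ∧ Function.Injective fun i => x i + y i

/-- A frame starter is skew if the sums `±(x i + y i)` hit each element of
`G \\ H` exactly once. -/
def IsSkewFS {G : Type*} [AddCommGroup G] (H : AddSubgroup G) {m : ℕ}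
    (x y : Fin m → G) : Prop :=
  CoversComplement H (Sum.elim (fun i => x i + y i) (fun i => -(x i + y i)))

/-- A function vanishing on `H` has the same total over `G` as over a family covering the
complement of `H`. -/
lemma CoversComplement.sum_add_sum {G M : Type*} [AddCommGroup G] [Fintype G] [AddCommMonoid M]
    {H : AddSubgroup G} {m : ℕ} {f : Fin m ⊕ Fin m → G} (hf : CoversComplement H f)
    (F : G → M) (hF : ∀ z ∈ H, F z = 0) :
    ∑ i, F (f (.inl i)) + ∑ i, F (f (.inr i)) = ∑ z, F z := by
  rw [← Fintype.sum_sum_type (fun i => F (f i))]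
  refine Fintype.sum_of_injective f hf.1 _ _ (fun z hz => hF z ?_) fun _ => rfl
  simpa [hf.2] using hz

/-- If a ring homomorphism `φ` kills `H`, a skew frame starter in `G \ H` forces twice the sum
of the squares `φ z ^ 2` to vanish. -/
lemma two_mul_sum_sq_eq_zero {G R : Type*} [CommRing G] [Fintype G] [CommRing R]
    {H : AddSubgroup G} {m : ℕ} {x y : Fin m → G} (hS : IsFrameStarter H x y)
    (hskew : IsSkewFS H x y) (φ : G →+* R) (hφ : ∀ z ∈ H, φ z = 0) :
    2 * ∑ z, φ z ^ 2 = 0 := by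
  have hF : ∀ z ∈ H, φ z ^ 2 = 0 := fun z hz => by simp [hφ z hz]
  have entries := hS.1.sum_add_sum (fun z => φ z ^ 2) hF
  have diffs := hS.2.sum_add_sum (fun z => φ z ^ 2) hF
  have sums := CoversComplement.sum_add_sum hskew (fun z => φ z ^ 2) hF
  simp only [Sum.elim_inl, Sum.elim_inr, map_sub, map_neg, map_add] at entries diffs sums
  have parallelogram :
      (∑ i, (φ (x i) - φ (y i)) ^ 2 + ∑ i, (φ (y i) - φ (x i)) ^ 2) +
        (∑ i, (φ (x i) + φ (y i)) ^ 2 + ∑ i, (-(φ (x i) + φ (y i))) ^ 2) =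
      4 * (∑ i, φ (x i) ^ 2 + ∑ i, φ (y i) ^ 2) := by
    simp only [← Finset.sum_add_distrib, Finset.mul_sum]
    exact Finset.sum_congr rfl fun i _ => by ring
  rw [entries, diffs, sums] at parallelogram
  linear_combination -parallelogram

lemma sum_range_three_mul_sq (n : ℕ) :
    ∑ k ∈ Finset.range (3 * n), (k : ZMod 3) ^ 2 = 2 * n := by
  have h3 : (3 : ZMod 3) = 0 := rfl
  induction n with
  | zero => simp
  | succ n ih =>
    rw [Nat.mul_succ, Finset.sum_range_succ, Finset.sum_range_succ, Finset.sum_range_succ, ih]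
    push_cast
    linear_combination (9 * (n : ZMod 3) ^ 2 + 6 * n + 1) * h3

lemma ZMod.sum_val {M : Type*} [AddCommMonoid M] (N : ℕ) [NeZero N] (f : ℕ → M) :
    ∑ z : ZMod N, f z.val = ∑ k ∈ Finset.range N, f k := by
  obtain _ | N := N
  · exact absurd rfl (NeZero.ne 0)
  · exact Fin.sum_univ_eq_sum_range f (N + 1)

/-- If `h * t ≢ 0 (mod 3)`, then there is no cyclic skew frame
starter of type `h^(3t)` in `ℤ_{3ht}` (with `H` the subgroup of order `h`,
generated by `3t`). -/
theorem stmt12 (h t : ℕ) (hh : 0 < h) (ht : 0 < t) (hmod : ¬ 3 ∣ h * t) :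
    ¬ ∃ (m : ℕ) (x y : Fin m → ZMod (3 * h * t)),
      IsFrameStarter (AddSubgroup.zmultiples ((3 * t : ℕ) : ZMod (3 * h * t))) x y ∧
        IsSkewFS (AddSubgroup.zmultiples ((3 * t : ℕ) : ZMod (3 * h * t))) x y := by
  rintro ⟨m, x, y, hS, hskew⟩
  have : NeZero (3 * h * t) := ⟨by positivity⟩
  have hdvd : 3 ∣ 3 * h * t := ⟨h * t, by ring⟩
  have h3 : (3 : ZMod 3) = 0 := rfl
  have key := two_mul_sum_sq_eq_zero hS hskew (ZMod.castHom hdvd (ZMod 3)) (by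
    rintro _ ⟨k, rfl⟩
    simp only [zsmul_eq_mul, map_mul, map_natCast, Nat.cast_mul, Nat.cast_ofNat, map_ofNat, h3]
    ring)
  simp only [ZMod.castHom_apply, ZMod.cast_eq_val] at key
  rw [ZMod.sum_val _ (fun k => (k : ZMod 3) ^ 2), mul_assoc 3 h t, sum_range_three_mul_sq] at key
  refine hmod ((ZMod.natCast_eq_zero_iff _ _).1 ?_)
  linear_combination key - ((h * t : ℕ) : ZMod 3) * h3
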